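/- Let P ⊂ ℝ^d be a full-dimensional rational reflexive polytope with denominator q. Then h*_P(z) has degree q(d+1)−1 and is palindromic: z^{q(d+1)−1}·h*_P(1/z) = h*_P(z). -/

import Mathlib

open Pointwise

/-- `x ∈ ℤ^d`, i.e. every coordinate of `x` is an integer. -/
def IsLatticePt {d : ℕ} (x : Fin d → ℝ) : Prop := ∀ i, ∃ a : ℤ, x i = (a : ℝ)

/-- `x ∈ ℚ^d`, i.e. every coordinate of `x` is rational. -/
def IsRationalPt {d : ℕ} (x : Fin d → ℝ) : Prop := ∀ i, ∃ a : ℚ, x i = (a : ℝ)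

/-- `P` is a lattice polytope: the convex hull of finitely many points of `ℤ^d`. -/
def IsLatticePolytope {d : ℕ} (P : Set (Fin d → ℝ)) : Prop :=
  ∃ V : Finset (Fin d → ℝ), (∀ v ∈ V, IsLatticePt v) ∧ P = convexHull ℝ (V : Set (Fin d → ℝ))

/-- `P` is a rational polytope: the convex hull of finitely many points of `ℚ^d`. -/
def IsRationalPolytope {d : ℕ} (P : Set (Fin d → ℝ)) : Prop :=
  ∃ V : Finset (Fin d → ℝ), (∀ v ∈ V, IsRationalPt v) ∧ P = convexHull ℝ (V : Set (Fin d → ℝ))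

/-- A convex subset of `ℝ^d` is full-dimensional iff its interior is nonempty. -/
def IsFullDim {d : ℕ} (P : Set (Fin d → ℝ)) : Prop := (interior P).Nonempty

/-- The number of lattice points in `S`. -/
noncomputable def latCount {d : ℕ} (S : Set (Fin d → ℝ)) : ℕ :=
  Set.ncard {x ∈ S | IsLatticePt x}

/-- The Ehrhart series `Ehr_P(z) = 1 + ∑_{n ≥ 1} #(nP ∩ ℤ^d) zⁿ`. -/
noncomputable def ehrSeries {d : ℕ} (P : Set (Fin d → ℝ)) : PowerSeries ℤ :=
  PowerSeries.mk fun n => if n = 0 then 1 else (latCount ((n : ℝ) • P) : ℤ)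

/-- The interior Ehrhart series `∑_{n ≥ 1} #(nP° ∩ ℤ^d) zⁿ`. -/
noncomputable def ehrIntSeries {d : ℕ} (P : Set (Fin d → ℝ)) : PowerSeries ℤ :=
  PowerSeries.mk fun n => if n = 0 then 0 else (latCount (interior ((n : ℝ) • P)) : ℤ)

/-- The boundary Ehrhart series `1 + ∑_{n ≥ 1} #(n ∂P ∩ ℤ^d) zⁿ`. -/
noncomputable def ehrBdSeries {d : ℕ} (P : Set (Fin d → ℝ)) : PowerSeries ℤ :=
  PowerSeries.mk fun n => if n = 0 then 1 else (latCount (frontier ((n : ℝ) • P)) : ℤ)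

/-- `q` is the denominator of `P`: the smallest positive integer such that `qP` is a
lattice polytope. -/
def IsDenominator {d : ℕ} (P : Set (Fin d → ℝ)) (q : ℕ) : Prop :=
  0 < q ∧ IsLatticePolytope ((q : ℝ) • P) ∧
    ∀ k : ℕ, 0 < k → IsLatticePolytope ((k : ℝ) • P) → q ≤ k

/-- `l` is the smallest positive integer such that the interior of `lP` contains a
lattice point. -/
def IsMinInteriorDilate {d : ℕ} (P : Set (Fin d → ℝ)) (l : ℕ) : Prop :=
  0 < l ∧ (∃ x, IsLatticePt x ∧ x ∈ interior ((l : ℝ) • P)) ∧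
    ∀ k : ℕ, 0 < k → (∃ x, IsLatticePt x ∧ x ∈ interior ((k : ℝ) • P)) → l ≤ k

/-- The homogenization of the half-open simplex with vertices `w 0, …, w (k-1)`
where the facets opposite the first `r` vertices are removed:
`hom(Δ) = Σ_{j<r} ℝ_{>0} (w j, 1) + Σ_{j≥r} ℝ_{≥0} (w j, 1) ⊆ ℝ^{d+1}`. -/
def homog {d k : ℕ} (w : Fin k → (Fin d → ℝ)) (r : ℕ) : Set (Fin (d + 1) → ℝ) :=
  {y | ∃ c : Fin k → ℝ, (∀ j : Fin k, (j : ℕ) < r → 0 < c j) ∧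
    (∀ j : Fin k, r ≤ (j : ℕ) → 0 ≤ c j) ∧
    y = ∑ j : Fin k, c j • (Fin.snoc (w j) 1 : Fin (d + 1) → ℝ)}

/-- The fundamental parallelepiped
`F'_Δ = Σ_{j<r} (0,1] (q_j w_j, q_j) + Σ_{j≥r} [0,1) (q_j w_j, q_j) ⊆ ℝ^{d+1}`. -/
def fpar {d k : ℕ} (w : Fin k → (Fin d → ℝ)) (r : ℕ) (q : Fin k → ℕ) :
    Set (Fin (d + 1) → ℝ) :=
  {y | ∃ c : Fin k → ℝ, (∀ j : Fin k, (j : ℕ) < r → c j ∈ Set.Ioc (0 : ℝ) 1) ∧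
    (∀ j : Fin k, r ≤ (j : ℕ) → c j ∈ Set.Ico (0 : ℝ) 1) ∧
    y = ∑ j : Fin k, c j • ((q j : ℝ) • (Fin.snoc (w j) 1 : Fin (d + 1) → ℝ))}

/-- The generating function `∑_{x ∈ S ∩ ℤ^{d+1}} z^{x_{d+1}}` of a subset `S ⊆ ℝ^{d+1}`,
graded by the last coordinate. -/
noncomputable def sliceSeries {d : ℕ} (S : Set (Fin (d + 1) → ℝ)) : PowerSeries ℤ :=
  PowerSeries.mk fun n =>
    (Set.ncard {y ∈ S | IsLatticePt y ∧ y (Fin.last d) = (n : ℝ)} : ℤ)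

/-- A polynomial is palindromic if `z^{deg f} f(1/z) = f(z)`,
i.e. `f_i = f_{deg f − i}` for all `i ≤ deg f`. -/
def IsPalin (f : Polynomial ℤ) : Prop :=
  ∀ i ≤ f.natDegree, f.coeff i = f.coeff (f.natDegree - i)

/-- `P` is rational reflexive: the origin is an interior point and `P = {x : A x ≤ 𝟙}`
for some integer matrix `A`. -/
def IsRationalReflexive {d : ℕ} (P : Set (Fin d → ℝ)) : Prop :=
  IsRationalPolytope P ∧ (0 : Fin d → ℝ) ∈ interior P ∧
    ∃ (m : ℕ) (A : Fin m → Fin d → ℤ),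
      P = {x : Fin d → ℝ | ∀ j, (∑ i, (A j i : ℝ) * x i) ≤ 1}

/-- `P` is a reflexive (lattice) polytope. -/
def IsReflexive {d : ℕ} (P : Set (Fin d → ℝ)) : Prop :=
  IsLatticePolytope P ∧ (0 : Fin d → ℝ) ∈ interior P ∧
    ∃ (m : ℕ) (A : Fin m → Fin d → ℤ),
      P = {x : Fin d → ℝ | ∀ j, (∑ i, (A j i : ℝ) * x i) ≤ 1}

/-- `P` is an integral translate of a reflexive polytope. -/
def IsTranslatedReflexive {d : ℕ} (P : Set (Fin d → ℝ)) : Prop :=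
  ∃ (Q : Set (Fin d → ℝ)) (t : Fin d → ℤ), IsReflexive Q ∧
    P = (fun y => y + fun i => (t i : ℝ)) '' Q

/-- The rational Ehrhart series `1 + ∑_{n ≥ 1} #((n/r) P ∩ ℤ^d) wⁿ`. -/
noncomputable def ratEhrSeries {d : ℕ} (P : Set (Fin d → ℝ)) (r : ℕ) : PowerSeries ℤ :=
  PowerSeries.mk fun n => if n = 0 then 1 else (latCount (((n : ℝ) / (r : ℝ)) • P) : ℤ)

/-- The rational boundary Ehrhart series `1 + ∑_{n ≥ 1} #((n/r) ∂P ∩ ℤ^d) wⁿ`. -/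
noncomputable def ratEhrBdSeries {d : ℕ} (P : Set (Fin d → ℝ)) (r : ℕ) : PowerSeries ℤ :=
  PowerSeries.mk fun n =>
    if n = 0 then 1 else (latCount (frontier (((n : ℝ) / (r : ℝ)) • P)) : ℤ)

/-- `r` is the codenominator of `P`: given an irredundant halfspace description
`P = {x : A x ≤ b}` with integer data and `gcd(b_j, A_{j,1}, …, A_{j,d}) = 1` for each `j`,
`r` is the least common multiple of the nonzero entries of `b`. -/
def IsCodenominator {d : ℕ} (P : Set (Fin d → ℝ)) (r : ℕ) : Prop :=
  ∃ (m : ℕ) (A : Fin m → Fin d → ℤ) (b : Fin m → ℤ),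
    P = {x : Fin d → ℝ | ∀ j, (∑ i, (A j i : ℝ) * x i) ≤ (b j : ℝ)} ∧
    (∀ j₀ : Fin m,
      P ≠ {x : Fin d → ℝ | ∀ j, j ≠ j₀ → (∑ i, (A j i : ℝ) * x i) ≤ (b j : ℝ)}) ∧
    (∀ j, Int.gcd (b j) (Finset.univ.gcd fun i => A j i) = 1) ∧
    (r : ℤ) = (Finset.univ.filter fun j => b j ≠ 0).lcm b

section
open Filter Topology

def DualB {E : Type*} [AddCommGroup E] [Module ℝ E] (T : Finset E) (l : E → (E →ₗ[ℝ] ℝ)) : Prop :=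
  (∀ x, ∑ i ∈ T, l i x • i = x) ∧ ∀ i ∈ T, ∀ j ∈ T, i ≠ j → l i j = 0

def lpos (a b : ℝ) : Prop := 0 < a ∨ (a = 0 ∧ 0 < b)

lemma lpos_neg {a b : ℝ} (hb : b ≠ 0) : lpos (-a) (-b) ↔ ¬ lpos a b := by
  unfold lpos
  rcases lt_trichotomy a 0 with h | h | h
  · simp [h, not_lt.2 h.le, h.ne]
  · subst h
    rcases lt_or_gt_of_ne hb with h | h
    · simp [h, not_lt.2 h.le]
    · simp [h, h.le]
  · simp [h, h.le, h.ne']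

lemma lpos_nonneg {a b : ℝ} (h : lpos a b) : 0 ≤ a := by
  rcases h with h | ⟨h, _⟩
  · exact h.le
  · exact h.ge

lemma lpos_of_sub_one {a b : ℝ} (h : lpos (a - 1) b) : lpos a b := by
  have := lpos_nonneg h
  left; linarith

lemma eventually_lpos {a b : ℝ} (hb : b ≠ 0) :
    ∀ᶠ e in 𝓝[>] (0 : ℝ), a + e * b ≠ 0 ∧ (0 < a + e * b ↔ lpos a b) := by
  have hc : Tendsto (fun e : ℝ => a + e * b) (𝓝[>] 0) (𝓝 a) := by
    have : Tendsto (fun e : ℝ => a + e * b) (𝓝 0) (𝓝 (a + 0 * b)) := by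
      apply Continuous.tendsto; fun_prop
    simpa using this.mono_left nhdsWithin_le_nhds
  rcases lt_trichotomy a 0 with h | h | h
  · filter_upwards [hc.eventually_lt_const h] with e he
    refine ⟨he.ne, ?_⟩
    simp [lpos, not_lt.2 he.le, not_lt.2 h.le, h.ne]
  · subst h
    filter_upwards [self_mem_nhdsWithin] with e he
    have he : 0 < e := he
    refine ⟨by simp [he.ne', hb], ?_⟩
    simp [lpos, he]
  · filter_upwards [hc.eventually_const_lt h] with e he
    refine ⟨he.ne', ?_⟩
    simp [lpos, he, h]

section
variable {E : Type*} [AddCommGroup E] [Module ℝ E]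

lemma exists_generic {ι : Type*} (s : Finset ι) (f : ι → (E →ₗ[ℝ] ℝ)) (h : ∀ i ∈ s, f i ≠ 0) :
    ∃ x, ∀ i ∈ s, f i x ≠ 0 := by
  classical
  by_contra hcon
  push Not at hcon
  have := Subspace.biUnion_ne_univ_of_top_notMem (k := ℝ) (E := E) (s := s.image fun i => LinearMap.ker (f i)) (by
    intro hh
    obtain ⟨i, hi, h2⟩ := Finset.mem_image.1 hh
    exact h i hi (LinearMap.ker_eq_top.1 h2))
  apply this
  ext x
  obtain ⟨i, hi, hx⟩ := hcon x
  simp only [Set.mem_iUnion, Set.mem_univ, iff_true]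
  exact ⟨LinearMap.ker (f i), Finset.mem_image_of_mem _ hi, hx⟩

lemma DualB.zero_notMem' {T : Finset E} {l : E → (E →ₗ[ℝ] ℝ)} (h : DualB T l) (j : E) (hj : j ∈ T)
    (hj0 : j ≠ 0) : l j j = 1 := by
  have h1 := h.1 j
  rw [Finset.sum_eq_single j (fun i hi hij => by rw [h.2 i hi j hj hij, zero_smul])
    (fun h' => absurd hj h')] at h1
  have : (l j j - 1) • j = 0 := by rw [sub_smul, h1, one_smul, sub_self]
  rcases smul_eq_zero.1 this with h | h
  · linarith
  · exact absurd h hj0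

/-- uniqueness of coordinates -/
lemma DualB.coord {T : Finset E} {l : E → (E →ₗ[ℝ] ℝ)} (h : DualB T l) (h0 : (0 : E) ∉ T)
    {x : E} (a : E → ℝ) (hx : ∑ i ∈ T, a i • i = x) (j : E) (hj : j ∈ T) : l j x = a j := by
  have hj0 : j ≠ 0 := fun h => h0 (h ▸ hj)
  rw [← hx, map_sum, Finset.sum_eq_single j]
  · simp [h.zero_notMem' j hj hj0]
  · intro i hi hij
    simp [h.2 j hj i hi hij.symm]
  · intro h'; exact absurd hj h'

lemma DualB.linInd {T : Finset E} {l : E → (E →ₗ[ℝ] ℝ)} (h : DualB T l) (h0 : (0 : E) ∉ T) :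
    LinearIndepOn ℝ id (T : Set E) := by
  rw [linearIndepOn_finset_iff]
  intro a ha i hi
  have := h.coord h0 a (x := 0) (by simpa using ha) i hi
  simpa using this.symm

lemma DualB.card [FiniteDimensional ℝ E] {T : Finset E} {l : E → (E →ₗ[ℝ] ℝ)} (h : DualB T l)
    (h0 : (0 : E) ∉ T) : T.card = Module.finrank ℝ E := by
  have hl := h.linInd h0
  have hs : Submodule.span ℝ (T : Set E) = ⊤ := by
    rw [eq_top_iff]
    intro x _
    rw [← h.1 x]
    exact Submodule.sum_mem _ fun i hi => Submodule.smul_mem _ _ (Submodule.subset_span hi)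
  have := finrank_span_finset_eq_card hl
  rw [hs, finrank_top] at this
  exact this.symm

lemma exists_dualB {T : Finset E} (hl : LinearIndepOn ℝ id (T : Set E))
    (hs : ⊤ ≤ Submodule.span ℝ (T : Set E)) : ∃ l, DualB T l := by
  classical
  have hl' : LinearIndependent ℝ (fun i : T => (i : E)) := hl
  let b := Module.Basis.mk hl' (by simpa using hs)
  have hb : ∀ i : T, b i = i := fun i => by simp [b]
  refine ⟨fun i => if hi : i ∈ T then b.coord ⟨i, hi⟩ else 0, ?_, ?_⟩
  · intro x
    rw [← Finset.sum_attach]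
    have := b.sum_repr x
    conv_rhs => rw [← this]
    apply Finset.sum_congr rfl
    intro i _
    simp [hb]
  · intro i hi j hj hij
    have : b.repr j = Finsupp.single ⟨j, hj⟩ 1 := by
      have h2 := b.repr_self ⟨j, hj⟩
      rwa [hb] at h2
    simp [hi, this, hij.symm]

lemma DualB.pivot [DecidableEq E] {T : Finset E} {l : E → (E →ₗ[ℝ] ℝ)} (h : DualB T l)
    (h0 : (0 : E) ∉ T) {i j : E}
    (hi : i ∈ T) (hj : j ∉ T) (hm : l i j ≠ 0) : ∃ l', DualB (insert j (T.erase i)) l' := by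
  refine ⟨fun k => if k = j then (l i j)⁻¹ • l i else l k - (l k j / l i j) • l i, ?_, ?_⟩
  · intro x
    rw [Finset.sum_insert (by simp [hj])]
    have : ∀ k ∈ T.erase i, (if k = j then (l i j)⁻¹ • l i else l k - (l k j / l i j) • l i) x • k
        = (l k x - l k j / l i j * l i x) • k := by
      intro k hk
      rw [if_neg]
      · simp
      · rintro rfl; exact hj (Finset.mem_of_mem_erase hk)
    rw [Finset.sum_congr rfl this, Finset.sum_erase]
    · simp only [sub_smul, Finset.sum_sub_distrib, h.1 x]
      have : ∑ k ∈ T, (l k j / l i j * l i x) • k = (l i x / l i j) • j := by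
        have h2 : (l i x / l i j) • ∑ k ∈ T, l k j • k = (l i x / l i j) • j := by rw [h.1 j]
        rw [← h2, Finset.smul_sum]
        apply Finset.sum_congr rfl
        intro k _
        rw [smul_smul]; congr 1; ring
      rw [this]
      simp only [if_true, LinearMap.smul_apply, smul_eq_mul]
      rw [div_eq_inv_mul]; abel
    · rw [div_self hm]; simp
  · have hii := h.zero_notMem' i hi (fun h => h0 (h ▸ hi))
    intro a ha b hb hab
    rw [Finset.mem_insert, Finset.mem_erase] at ha hb
    rcases ha with rfl | ⟨ha1, ha2⟩
    · rcases hb with rfl | ⟨hb1, hb2⟩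
      · exact absurd rfl hab
      · simp [h.2 i hi b hb2 hb1.symm]
    · have haj : a ≠ j := by rintro rfl; exact hj ha2
      rcases hb with rfl | ⟨hb1, hb2⟩
      · simp [haj, hm]
      · simp [haj, h.2 i hi b hb2 hb1.symm, h.2 a ha2 b hb2 hab]

def coneOf (V : Finset E) : Set E := {z | ∃ a : E → ℝ, (∀ i ∈ V, 0 ≤ a i) ∧ ∑ i ∈ V, a i • i = z}

structure Setup (V : Finset E) (ht : E →ₗ[ℝ] ℝ) (q : ℕ) : Prop where
  hq : 0 < q
  hne : V.Nonempty
  hht : ∀ w ∈ V, ht w = q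
  hspan : ⊤ ≤ Submodule.span ℝ (V : Set E)

lemma Setup.zero_notMem {V : Finset E} {ht : E →ₗ[ℝ] ℝ} {q : ℕ} (S : Setup V ht q) :
    (0 : E) ∉ V := by
  intro h
  have := S.hht 0 h
  simp at this
  exact S.hq.ne (by exact_mod_cast this)

lemma Setup.ht_eq {V : Finset E} {ht : E →ₗ[ℝ] ℝ} {q : ℕ} (S : Setup V ht q) {T : Finset E}
    (hT : T ⊆ V) {l : E → (E →ₗ[ℝ] ℝ)} (h : DualB T l) (x : E) :
    ht x = q * ∑ i ∈ T, l i x := by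
  conv_lhs => rw [← h.1 x]
  rw [map_sum, Finset.mul_sum]
  apply Finset.sum_congr rfl
  intro i hi
  rw [map_smul, S.hht i (hT hi), smul_eq_mul, mul_comm]

/-- Caratheodory -/
lemma Setup.carath {V : Finset E} {ht : E →ₗ[ℝ] ℝ} {q : ℕ} (S : Setup V ht q) {z : E}
    (hz : z ∈ coneOf V) (hz0 : 0 < ht z) :
    ∃ T ⊆ V, ∃ l, DualB T l ∧ ∀ i ∈ T, 0 ≤ l i z := by
  classical
  obtain ⟨a, ha, rfl⟩ := hz
  have hq : (0 : ℝ) < q := by exact_mod_cast S.hq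
  set z := ∑ i ∈ V, a i • i with hzdef
  have hht : ht z = (∑ i ∈ V, a i) * q := by
    rw [hzdef, map_sum, Finset.sum_mul]
    exact Finset.sum_congr rfl fun i hi => by simp [S.hht i hi]
  have hsum : 0 < ∑ i ∈ V, a i := by
    by_contra hc
    push Not at hc
    nlinarith
  have hmem : (∑ i ∈ V, a i)⁻¹ • z ∈ convexHull ℝ (V : Set E) := by
    have := Finset.centerMass_mem_convexHull (R := ℝ) V (w := a) (z := id) (s := (V : Set E)) ha hsum
      (fun i hi => hi)
    simpa [Finset.centerMass] using this
  obtain ⟨ι, _, y, w, hy, hai, hw, hw1, hwz⟩ := eq_pos_convex_span_of_mem_convexHull hmem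
  have hyV : ∀ i, y i ∈ V := fun i => hy ⟨i, rfl⟩
  have hli : LinearIndependent ℝ y := by
    rw [Fintype.linearIndependent_iff]
    intro g hg
    have hg1 : ∑ i, g i = 0 := by
      have := congrArg ht hg
      simp only [map_sum, map_smul, S.hht _ (hyV _), smul_eq_mul, map_zero] at this
      rw [← Finset.sum_mul] at this
      exact (mul_eq_zero.1 this).resolve_right hq.ne'
    have := affineIndependent_iff.1 hai Finset.univ g hg1 (by simpa using hg)
    intro i; exact this i (Finset.mem_univ i)
  have hlr : LinearIndepOn ℝ id (Set.range y) := hli.linearIndepOn_id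
  obtain ⟨b, hbV, hrb, hVb, hlb⟩ := exists_linearIndepOn_id_extension hlr hy
  have hbf : b.Finite := V.finite_toSet.subset hbV
  obtain ⟨T, rfl⟩ := hbf.exists_finset_coe
  have hT : T ⊆ V := by exact_mod_cast hbV
  have hs : ⊤ ≤ Submodule.span ℝ (T : Set E) := S.hspan.trans (Submodule.span_le.2 hVb)
  obtain ⟨l, hl⟩ := exists_dualB hlb hs
  refine ⟨T, hT, l, hl, ?_⟩
  have h0 : (0 : E) ∉ T := fun h => S.zero_notMem (hT h)
  intro i hi
  have hz' : z = ∑ k, ((∑ i ∈ V, a i) * w k) • y k := by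
    simp only [← smul_smul]
    rw [← Finset.smul_sum, hwz, smul_smul, mul_inv_cancel₀ hsum.ne', one_smul]
  rw [hz', map_sum]
  apply Finset.sum_nonneg
  intro k _
  rw [map_smul, smul_eq_mul]
  apply mul_nonneg (mul_nonneg hsum.le (hw k).le)
  by_cases hik : i = y k
  · rw [← hik, hl.zero_notMem' i hi (fun h => h0 (h ▸ hi))]; norm_num
  · rw [hl.2 i hi (y k) (hrb ⟨k, rfl⟩) hik]

open Classical in
noncomputable def basesOf (V : Finset E) : Finset (Finset E) :=
  V.powerset.filter fun T => ∃ l, DualB T l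

open Classical in
noncomputable def lam (T : Finset E) : E → (E →ₗ[ℝ] ℝ) :=
  if h : ∃ l, DualB T l then h.choose else 0

lemma mem_basesOf {V T : Finset E} : T ∈ basesOf V ↔ T ⊆ V ∧ ∃ l, DualB T l := by
  classical
  simp [basesOf]

lemma dual_lam {V T : Finset E} (h : T ∈ basesOf V) : DualB T (lam T) := by
  have h2 := (mem_basesOf.1 h).2
  unfold lam
  rw [dif_pos h2]
  exact h2.choose_spec

def Gen (V : Finset E) (z : E) : Prop := ∀ T ∈ basesOf V, ∀ i ∈ T, lam T i z ≠ 0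

def GenC (V : Finset E) (c : E → ℝ) : Prop :=
  ∀ T ∈ basesOf V, ∀ j ∈ V, j ∉ T → ∑ i ∈ T, c i * lam T i j ≠ c j

open Classical in
noncomputable def feas (V : Finset E) (c : E → ℝ) : Finset (Finset E) :=
  (basesOf V).filter fun T => ∀ j ∈ V, j ∉ T → ∑ i ∈ T, c i * lam T i j < c j

lemma mem_feas {V T : Finset E} {c : E → ℝ} : T ∈ feas V c ↔
    T ∈ basesOf V ∧ ∀ j ∈ V, j ∉ T → ∑ i ∈ T, c i * lam T i j < c j := by
  classical
  simp [feas]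

lemma exists_GenC (V : Finset E) : ∃ c, GenC V c := by
  classical
  obtain ⟨c, hc⟩ := exists_generic (E := E → ℝ)
    ((basesOf V ×ˢ V).filter fun p => p.2 ∉ p.1)
    (fun p => ∑ i ∈ p.1, lam p.1 i p.2 • LinearMap.proj i - LinearMap.proj p.2) (by
      rintro ⟨T, j⟩ hp
      simp only [Finset.mem_filter, Finset.mem_product] at hp
      intro h0
      have := LinearMap.congr_fun h0 (Pi.single j 1)
      simp only [LinearMap.sub_apply, LinearMap.sum_apply, LinearMap.smul_apply,
        LinearMap.proj_apply, LinearMap.zero_apply, Pi.single_eq_same] at this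
      rw [Finset.sum_eq_zero] at this
      · norm_num at this
      · intro i hi
        rw [Pi.single_eq_of_ne]
        · simp
        · rintro rfl; exact hp.2 hi)
  refine ⟨c, fun T hT j hj hjT h => ?_⟩
  apply hc (T, j) (by simp [hT, hj, hjT])
  simp only [LinearMap.sub_apply, LinearMap.sum_apply, LinearMap.smul_apply,
        LinearMap.proj_apply, smul_eq_mul]
  rw [← h, sub_eq_zero]
  exact Finset.sum_congr rfl fun i _ => mul_comm _ _

lemma exists_Gen (V : Finset E) (h0 : (0 : E) ∉ V) : ∃ z, Gen V z := by
  classical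
  obtain ⟨z, hz⟩ := exists_generic ((basesOf V ×ˢ V).filter fun p => p.2 ∈ p.1)
    (fun p => lam p.1 p.2) (by
      rintro ⟨T, j⟩ hp
      simp only [Finset.mem_filter, Finset.mem_product] at hp
      intro h
      have h1 := (dual_lam hp.1.1).zero_notMem' j hp.2 (fun h => h0 (h ▸ hp.1.2))
      have h : lam T j = 0 := h
      simp [h] at h1)
  refine ⟨z, fun T hT i hi => hz (T, i) ?_⟩
  simp [hT, hi, (mem_basesOf.1 hT).1 hi]

variable {V : Finset E} {ht : E →ₗ[ℝ] ℝ} {q : ℕ}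

lemma Setup.notMem (S : Setup V ht q) {T : Finset E} (hT : T ∈ basesOf V) : (0 : E) ∉ T :=
  fun h => S.zero_notMem ((mem_basesOf.1 hT).1 h)

lemma Setup.lp_unique (S : Setup V ht q) {c : E → ℝ} {z : E} {T T' : Finset E}
    (hT : T ∈ feas V c) (hT' : T' ∈ feas V c) (hz : ∀ i ∈ T, 0 < lam T i z)
    (hz' : ∀ i ∈ T', 0 < lam T' i z) : T' ⊆ T := by
  have key : ∀ T T' : Finset E, T ∈ feas V c → T' ∈ feas V c → 
      (∀ i ∈ T', 0 < lam T' i z) → 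
      (∑ i ∈ T, c i * lam T i z ≤ ∑ i ∈ T', c i * lam T' i z) ∧ 
      (¬ T' ⊆ T → ∑ i ∈ T, c i * lam T i z < ∑ i ∈ T', c i * lam T' i z) := by
    intro T T' hT hT' hz'
    rw [mem_feas] at hT hT'
    have hd := dual_lam hT.1
    have hd' := dual_lam hT'.1
    have h1 : ∑ i ∈ T, c i * lam T i z = ∑ j ∈ T', (∑ i ∈ T, c i * lam T i j) * lam T' j z := by
      simp only [Finset.sum_mul]
      rw [Finset.sum_comm]
      apply Finset.sum_congr rfl
      intro i hi
      conv_lhs => rw [← hd'.1 z]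
      rw [map_sum, Finset.mul_sum]
      apply Finset.sum_congr rfl
      intro j hj
      rw [map_smul, smul_eq_mul]
      ring
    have h2 : ∀ j ∈ T', ∑ i ∈ T, c i * lam T i j ≤ c j := by
      intro j hj
      by_cases hjT : j ∈ T
      · rw [Finset.sum_eq_single j]
        · rw [hd.zero_notMem' j hjT (fun h => S.notMem hT.1 (h ▸ hjT)), mul_one]
        · intro i hi hij
          rw [hd.2 i hi j hjT hij, mul_zero]
        · intro h; exact absurd hjT h
      · exact (hT.2 j ((mem_basesOf.1 hT'.1).1 hj) hjT).le
    rw [h1]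
    constructor
    · exact Finset.sum_le_sum fun j hj => mul_le_mul_of_nonneg_right (h2 j hj) (hz' j hj).le
    · intro hn
      obtain ⟨j, hj, hjT⟩ := Finset.not_subset.1 hn
      apply Finset.sum_lt_sum
      · exact fun j hj => mul_le_mul_of_nonneg_right (h2 j hj) (hz' j hj).le
      · exact ⟨j, hj, mul_lt_mul_of_pos_right
          (hT.2 j ((mem_basesOf.1 hT'.1).1 hj) hjT) (hz' j hj)⟩
  by_contra hn
  have a := (key T T' hT hT' hz').2 hn
  have b := (key T' T hT' hT hz).1
  linarith

lemma Setup.lp_exists (S : Setup V ht q) {c : E → ℝ} (hc : GenC V c) {z : E} (hg : Gen V z)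
    (hz : z ∈ coneOf V) (hz0 : 0 < ht z) :
    ∃ T ∈ feas V c, ∀ i ∈ T, 0 < lam T i z := by
  classical
  have hq : (0 : ℝ) < q := by exact_mod_cast S.hq
  have hne : ((basesOf V).filter fun T => ∀ i ∈ T, 0 < lam T i z).Nonempty := by
    obtain ⟨T, hTV, l, hl, hlz⟩ := S.carath hz hz0
    have hT : T ∈ basesOf V := mem_basesOf.2 ⟨hTV, l, hl⟩
    refine ⟨T, Finset.mem_filter.2 ⟨hT, fun i hi => ?_⟩⟩
    refine lt_of_le_of_ne ?_ (hg T hT i hi).symm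
    rw [(dual_lam hT).coord (S.notMem hT) (fun i => l i z) (hl.1 z) i hi]
    exact hlz i hi
  obtain ⟨T, hT, hmin⟩ := Finset.exists_min_image _ (fun T => ∑ i ∈ T, c i * lam T i z) hne
  obtain ⟨hTb, hTz⟩ := Finset.mem_filter.1 hT
  refine ⟨T, mem_feas.2 ⟨hTb, ?_⟩, hTz⟩
  intro j hjV hjT
  by_contra hcon
  have hlt : c j < ∑ i ∈ T, c i * lam T i j :=
    lt_of_le_of_ne (not_lt.1 hcon) (hc T hTb j hjV hjT).symm
  have hd := dual_lam hTb
  have h0 := S.notMem hTb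
  have hTV := (mem_basesOf.1 hTb).1
  have hpos : (T.filter fun i => 0 < lam T i j).Nonempty := by
    by_contra hn
    rw [Finset.not_nonempty_iff_eq_empty, Finset.filter_eq_empty_iff] at hn
    have h1 := S.ht_eq hTV hd j
    rw [S.hht j hjV] at h1
    have h2 : ∑ i ∈ T, lam T i j ≤ 0 := Finset.sum_nonpos fun i hi => not_lt.1 (hn hi)
    nlinarith
  obtain ⟨i, hi, himin⟩ := Finset.exists_min_image _ (fun i => lam T i z / lam T i j) hpos
  obtain ⟨hiT, hij⟩ := Finset.mem_filter.1 hi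
  set θ := lam T i z / lam T i j with hθ
  have hθ0 : 0 < θ := div_pos (hTz i hiT) hij
  set T' := insert j (T.erase i) with hT'
  have hT'b : T' ∈ basesOf V := by
    refine mem_basesOf.2 ⟨?_, hd.pivot h0 hiT hjT hij.ne'⟩
    intro k hk
    rw [hT', Finset.mem_insert, Finset.mem_erase] at hk
    rcases hk with rfl | ⟨_, hk⟩
    · exact hjV
    · exact hTV hk
  have hjne : ∀ k ∈ T.erase i, k ≠ j := by
    rintro k hk rfl; exact hjT (Finset.mem_of_mem_erase hk)
  let a : E → ℝ := fun k => if k = j then θ else lam T k z - θ * lam T k j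
  have hai : lam T i z - θ * lam T i j = 0 := by
    rw [hθ, div_mul_cancel₀ _ hij.ne', sub_self]
  have ha : ∑ k ∈ T', a k • k = z := by
    rw [hT', Finset.sum_insert (by simp [hjT])]
    have : ∀ k ∈ T.erase i, a k • k = (lam T k z - θ * lam T k j) • k := by
      intro k hk; simp only [a]; rw [if_neg (hjne k hk)]
    rw [Finset.sum_congr rfl this, Finset.sum_erase _ (by rw [hai, zero_smul])]
    simp only [sub_smul, Finset.sum_sub_distrib, hd.1 z, ← smul_smul]
    rw [← Finset.smul_sum, hd.1 j]
    simp [a]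
  have hcoord := (dual_lam hT'b).coord (S.notMem hT'b) a ha
  have hann : ∀ k ∈ T', 0 ≤ a k := by
    intro k hk
    simp only [a]
    split_ifs with hkj
    · exact hθ0.le
    · have hkT : k ∈ T := by
        rw [hT', Finset.mem_insert, Finset.mem_erase] at hk
        exact (hk.resolve_left hkj).2
      have hkz := hTz k hkT
      by_cases hkp : 0 < lam T k j
      · have := himin k (Finset.mem_filter.2 ⟨hkT, hkp⟩)
        rw [le_div_iff₀ hkp] at this
        linarith
      · nlinarith
  have hT'z : T' ∈ (basesOf V).filter fun T => ∀ i ∈ T, 0 < lam T i z := by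
    refine Finset.mem_filter.2 ⟨hT'b, fun k hk => lt_of_le_of_ne ?_ (hg T' hT'b k hk).symm⟩
    rw [hcoord k hk]; exact hann k hk
  have hm := hmin T' hT'z
  have : ∑ k ∈ T', c k * lam T' k z = ∑ k ∈ T, c k * lam T k z
      - θ * (∑ k ∈ T, c k * lam T k j - c j) := by
    rw [Finset.sum_congr rfl (fun k hk => by rw [hcoord k hk])]
    rw [hT', Finset.sum_insert (by simp [hjT])]
    have : ∀ k ∈ T.erase i, c k * a k = c k * (lam T k z - θ * lam T k j) := by
      intro k hk; simp only [a]; rw [if_neg (hjne k hk)]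
    rw [Finset.sum_congr rfl this, Finset.sum_erase _ (by rw [hai, mul_zero])]
    simp only [mul_sub, Finset.sum_sub_distrib, Finset.mul_sum]
    simp only [a, if_true]
    have : ∀ k, c k * (θ * lam T k j) = θ * (c k * lam T k j) := fun k => by ring
    simp only [this]
    ring
  rw [this] at hm
  nlinarith

lemma Setup.mem_cone_of (S : Setup V ht q) {z : E} {T : Finset E} (hT : T ∈ basesOf V)
    (h : ∀ i ∈ T, 0 < lam T i z) : z ∈ coneOf V ∧ 0 < ht z := by
  classical
  have hq : (0 : ℝ) < q := by exact_mod_cast S.hq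
  have hd := dual_lam hT
  have hTV := (mem_basesOf.1 hT).1
  constructor
  · refine ⟨fun i => if i ∈ T then lam T i z else 0, ?_, ?_⟩
    · intro i _
      dsimp only
      split_ifs with hi
      · exact (h i hi).le
      · exact le_rfl
    · simp only [ite_smul, zero_smul]
      rw [← Finset.sum_filter, Finset.filter_mem_eq_inter, Finset.inter_eq_right.2 hTV]
      exact hd.1 z
  · rw [S.ht_eq hTV hd z]
    refine mul_pos hq (Finset.sum_pos h ?_)
    by_contra hn
    rw [Finset.not_nonempty_iff_eq_empty] at hn
    obtain ⟨w, hw⟩ := S.hne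
    have := hd.1 w
    rw [hn, Finset.sum_empty] at this
    exact S.zero_notMem (this ▸ hw)
def Gset (L : AddSubgroup E) (ht : E →ₗ[ℝ] ℝ) (T : Finset E) (b : E → ℝ) (J : Finset E) (m : ℝ) :
    Set E :=
  {x | x ∈ L ∧ ht x = m ∧ ∀ i ∈ T, lpos (lam T i x) (b i) ∧ (i ∈ J → ¬ lpos (lam T i x - 1) (b i))}

def LFin (V : Finset E) (L : AddSubgroup E) : Prop :=
  ∀ T ∈ basesOf V, ∀ M : ℝ, {x | x ∈ L ∧ ∀ i ∈ T, |lam T i x| ≤ M}.Finite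

variable {L : AddSubgroup E}

lemma Gset_bound (S : Setup V ht q) {T : Finset E} (hT : T ∈ basesOf V) {b : E → ℝ}
    {J : Finset E} {m : ℝ} {x : E} (hx : x ∈ Gset L ht T b J m) :
    (∀ i ∈ T, 0 ≤ lam T i x) ∧ m = q * ∑ i ∈ T, lam T i x ∧ ∀ i ∈ T, q * lam T i x ≤ m := by
  have hq : (0 : ℝ) < q := by exact_mod_cast S.hq
  obtain ⟨_, hm, h⟩ := hx
  have h1 : ∀ i ∈ T, 0 ≤ lam T i x := fun i hi => lpos_nonneg (h i hi).1
  have h2 := S.ht_eq (mem_basesOf.1 hT).1 (dual_lam hT) x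
  rw [hm] at h2
  refine ⟨h1, h2, fun i hi => ?_⟩
  rw [h2]
  exact mul_le_mul_of_nonneg_left (Finset.single_le_sum h1 hi) hq.le

lemma Gset_finite (S : Setup V ht q) (hL : LFin V L) {T : Finset E} (hT : T ∈ basesOf V) (b : E → ℝ)
    (J : Finset E) (m : ℝ) : (Gset L ht T b J m).Finite := by
  have hq : (0 : ℝ) < q := by exact_mod_cast S.hq
  refine (hL T hT (m / q)).subset fun x hx => ⟨hx.1, fun i hi => ?_⟩
  obtain ⟨h1, _, h3⟩ := Gset_bound S hT hx
  rw [abs_of_nonneg (h1 i hi), le_div_iff₀ hq, mul_comm]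
  exact h3 i hi

lemma lam_add_self (S : Setup V ht q) {T : Finset E} (hT : T ∈ basesOf V) {i : E} (hi : i ∈ T)
    (x : E) : lam T i (x + i) = lam T i x + 1 ∧ ∀ k ∈ T, k ≠ i → lam T k (x + i) = lam T k x := by
  have hd := dual_lam hT
  constructor
  · rw [map_add, hd.zero_notMem' i hi (fun h => S.notMem hT (h ▸ hi))]
  · intro k hk hki
    rw [map_add, hd.2 k hk i hi hki, add_zero]

lemma Gset_step [DecidableEq E] (S : Setup V ht q) (hL : LFin V L) (hVL : ∀ w ∈ V, w ∈ L)
    {T : Finset E} (hT : T ∈ basesOf V) (b : E → ℝ) {J : Finset E} {i : E} (hi : i ∈ T)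
    (hJ : i ∉ J) (m : ℝ) :
    (Gset L ht T b (insert i J) m).ncard + (Gset L ht T b J (m - q)).ncard =
      (Gset L ht T b J m).ncard := by
  have hiV := (mem_basesOf.1 hT).1 hi
  have himg : (Gset L ht T b J (m - q)).ncard
      = ((fun x => x + i) '' Gset L ht T b J (m - q)).ncard :=
    (Set.ncard_image_of_injective _ (add_left_injective i)).symm
  rw [himg, ← Set.ncard_union_eq _ (Gset_finite S hL hT _ _ _)
    ((Gset_finite S hL hT _ _ _).image _)]
  · congr 1
    ext x
    simp only [Set.mem_union, Set.mem_image]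
    constructor
    · rintro (⟨h1, h2, h3⟩ | ⟨y, ⟨h1, h2, h3⟩, rfl⟩)
      · exact ⟨h1, h2, fun k hk => ⟨(h3 k hk).1, fun hkJ => (h3 k hk).2 (Finset.mem_insert_of_mem hkJ)⟩⟩
      · obtain ⟨ha, hb⟩ := lam_add_self S hT hi y
        refine ⟨L.add_mem h1 (hVL i hiV), by rw [map_add, h2, S.hht i hiV]; ring, fun k hk => ?_⟩
        by_cases hki : k = i
        · subst hki
          rw [ha]
          refine ⟨lpos_of_sub_one ?_, fun h => absurd h hJ⟩
          rw [add_sub_cancel_right]; exact (h3 k hk).1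
        · rw [hb k hk hki]; exact h3 k hk
    · rintro ⟨h1, h2, h3⟩
      by_cases hp : lpos (lam T i x - 1) (b i)
      · right
        refine ⟨x - i, ⟨L.sub_mem h1 (hVL i hiV), by rw [map_sub, h2, S.hht i hiV], fun k hk => ?_⟩,
          sub_add_cancel _ _⟩
        obtain ⟨ha, hb⟩ := lam_add_self S hT hi (x - i)
        rw [sub_add_cancel] at ha hb
        by_cases hki : k = i
        · subst hki
          refine ⟨?_, fun h => absurd h hJ⟩
          rw [ha, add_sub_cancel_right] at hp
          exact hp
        · rw [← hb k hk hki]; exact h3 k hk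
      · left
        refine ⟨h1, h2, fun k hk => ⟨(h3 k hk).1, fun hkJ => ?_⟩⟩
        rcases Finset.mem_insert.1 hkJ with rfl | hkJ
        · exact hp
        · exact (h3 k hk).2 hkJ
  · rw [Set.disjoint_left]
    rintro x ⟨h1, h2, h3⟩ ⟨y, ⟨g1, g2, g3⟩, rfl⟩
    apply (h3 i hi).2 (Finset.mem_insert_self _ _)
    dsimp only
    rw [(lam_add_self S hT hi y).1, add_sub_cancel_right]
    exact (g3 i hi).1

lemma Gset_neg (S : Setup V ht q) {T : Finset E} (hT : T ∈ basesOf V) (b : E → ℝ) (J : Finset E)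
    {m : ℝ} (hm : m < 0) : Gset L ht T b J m = ∅ := by
  have hq : (0 : ℝ) < q := by exact_mod_cast S.hq
  rw [Set.eq_empty_iff_forall_notMem]
  intro x hx
  obtain ⟨h1, h2, _⟩ := Gset_bound S hT hx
  have := Finset.sum_nonneg h1
  nlinarith

noncomputable def gser (L : AddSubgroup E) (ht : E →ₗ[ℝ] ℝ) (T : Finset E) (b : E → ℝ)
    (J : Finset E) : PowerSeries ℤ := PowerSeries.mk fun n => ((Gset L ht T b J n).ncard : ℤ)

lemma gser_step [DecidableEq E] (S : Setup V ht q) (hL : LFin V L) (hVL : ∀ w ∈ V, w ∈ L)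
    {T : Finset E} (hT : T ∈ basesOf V) (b : E → ℝ) {J : Finset E} {i : E} (hi : i ∈ T)
    (hJ : i ∉ J) : (1 - PowerSeries.X ^ q) * gser L ht T b J = gser L ht T b (insert i J) := by
  ext n
  rw [sub_mul, one_mul, map_sub, PowerSeries.coeff_X_pow_mul']
  simp only [gser, PowerSeries.coeff_mk]
  have h := Gset_step S hL hVL hT b hi hJ n
  split_ifs with hn
  · rw [Nat.cast_sub hn]
    rw [← h]; push_cast; ring
  · rw [Gset_neg S hT b J (m := n - q) (by rw [sub_neg]; exact_mod_cast not_le.1 hn)] at h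
    rw [← h]; simp

lemma gser_all (S : Setup V ht q) (hL : LFin V L) (hVL : ∀ w ∈ V, w ∈ L)
    {T : Finset E} (hT : T ∈ basesOf V) (b : E → ℝ) :
    (1 - PowerSeries.X ^ q) ^ T.card * gser L ht T b ∅ = gser L ht T b T := by
  classical
  have : ∀ J ⊆ T, (1 - PowerSeries.X ^ q) ^ J.card * gser L ht T b ∅ = gser L ht T b J := by
    intro J
    induction J using Finset.induction_on with
    | empty => intro _; simp
    | insert i J hiJ ih =>
      intro hJ
      rw [Finset.card_insert_of_notMem hiJ, pow_succ', mul_assoc,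
        ih (fun x hx => hJ (Finset.mem_insert_of_mem hx)),
        gser_step S hL hVL hT b (hJ (Finset.mem_insert_self _ _)) hiJ]
  exact this T subset_rfl

lemma Gset_recip (S : Setup V ht q) (hVL : ∀ w ∈ V, w ∈ L)
    {T : Finset E} (hT : T ∈ basesOf V) {b : E → ℝ} (hb : ∀ i ∈ T, b i ≠ 0) (m : ℝ) :
    (Gset L ht T b T m).ncard = (Gset L ht T (fun i => - b i) T (q * T.card - m)).ncard := by
  have hTV := (mem_basesOf.1 hT).1
  have hd := dual_lam hT
  have hsum : ∀ k ∈ T, lam T k (∑ i ∈ T, i) = 1 := by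
    intro k hk
    exact hd.coord (S.notMem hT) (fun _ => 1) (by simp) k hk
  have hsL : ∑ i ∈ T, i ∈ L := L.sum_mem fun i hi => hVL i (hTV hi)
  have hsh : ht (∑ i ∈ T, i) = q * T.card := by
    rw [S.ht_eq hTV hd, Finset.sum_congr rfl hsum]; simp
  have key : ∀ (b : E → ℝ) (m : ℝ) (x : E), (∀ i ∈ T, b i ≠ 0) → x ∈ Gset L ht T b T m →
      (∑ i ∈ T, i) - x ∈ Gset L ht T (fun i => - b i) T (q * T.card - m) := by
    rintro b m x hb ⟨h1, h2, h3⟩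
    refine ⟨L.sub_mem hsL h1, by rw [map_sub, hsh, h2], fun i hi => ?_⟩
    rw [map_sub, hsum i hi]
    obtain ⟨h4, h5⟩ := h3 i hi
    constructor
    · rw [show 1 - lam T i x = -(lam T i x - 1) by ring, lpos_neg (hb i hi)]
      exact h5 hi
    · intro _
      rw [show 1 - lam T i x - 1 = -(lam T i x) by ring, lpos_neg (hb i hi)]
      exact not_not.2 h4
  have himg : Gset L ht T (fun i => - b i) T (q * T.card - m)
      = (fun x => (∑ i ∈ T, i) - x) '' Gset L ht T b T m := by
    ext x
    constructor
    · intro hx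
      have := key _ _ x (fun i hi => neg_ne_zero.2 (hb i hi)) hx
      simp only [neg_neg, sub_sub_cancel] at this
      exact ⟨_, this, by simp⟩
    · rintro ⟨y, hy, rfl⟩
      exact key b m y hb hy
  rw [himg, Set.ncard_image_of_injective]
  exact sub_right_injective

/-- lattice points `x` of height `m` whose perturbation in direction `ξ` is in the cone -/
def Nset (V : Finset E) (L : AddSubgroup E) (ht : E →ₗ[ℝ] ℝ) (ξ : E) (m : ℝ) : Set E :=
  {x | x ∈ L ∧ ht x = m ∧
    ∀ᶠ e in 𝓝[>] (0 : ℝ), x + e • ξ ∈ coneOf V ∧ 0 < ht (x + e • ξ)}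

lemma Nset_eq (S : Setup V ht q) {c : E → ℝ} (hc : GenC V c) {ξ : E} (hξ : Gen V ξ) (m : ℝ) :
    Nset V L ht ξ m = ⋃ T ∈ feas V c, Gset L ht T (fun i => lam T i ξ) ∅ m ∧ 
    ∀ T ∈ feas V c, ∀ T' ∈ feas V c, T ≠ T' →
      Disjoint (Gset L ht T (fun i => lam T i ξ) ∅ m) (Gset L ht T' (fun i => lam T' i ξ) ∅ m) := by
  have hev : ∀ x : E, ∀ᶠ e in 𝓝[>] (0 : ℝ), ∀ T ∈ basesOf V, ∀ i ∈ T,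
      lam T i (x + e • ξ) ≠ 0 ∧ (0 < lam T i (x + e • ξ) ↔ lpos (lam T i x) (lam T i ξ)) := by
    intro x
    rw [Filter.eventually_all_finset]
    intro T hT
    rw [Filter.eventually_all_finset]
    intro i hi
    simpa using eventually_lpos (a := lam T i x) (hξ T hT i hi)
  constructor
  · ext x
    simp only [Set.mem_iUnion, exists_prop]
    constructor
    · rintro ⟨h1, h2, h3⟩
      obtain ⟨e, he, he1, he2⟩ := ((hev x).and h3).exists
      obtain ⟨T, hT, hTz⟩ := S.lp_exists hc (fun T hT i hi => (he T hT i hi).1) he1 he2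
      exact ⟨T, hT, h1, h2, fun i hi => 
        ⟨(he T (mem_feas.1 hT).1 i hi).2.1 (hTz i hi), fun h => absurd h (Finset.notMem_empty _)⟩⟩
    · rintro ⟨T, hT, h1, h2, h3⟩
      refine ⟨h1, h2, ?_⟩
      filter_upwards [hev x] with e he
      exact S.mem_cone_of (mem_feas.1 hT).1 fun i hi =>
        (he T (mem_feas.1 hT).1 i hi).2.2 (h3 i hi).1
  · intro T hT T' hT' hne
    rw [Set.disjoint_left]
    intro x hx hx'
    obtain ⟨e, he⟩ := (hev x).exists
    have hz : ∀ i ∈ T, 0 < lam T i (x + e • ξ) := fun i hi =>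
        (he T (mem_feas.1 hT).1 i hi).2.2 (hx.2.2 i hi).1
    have hz' : ∀ i ∈ T', 0 < lam T' i (x + e • ξ) := fun i hi =>
        (he T' (mem_feas.1 hT').1 i hi).2.2 (hx'.2.2 i hi).1
    exact hne (Finset.Subset.antisymm (S.lp_unique hT' hT hz' hz) (S.lp_unique hT hT' hz hz'))

lemma Nset_ncard (S : Setup V ht q) (hL : LFin V L) {c : E → ℝ} (hc : GenC V c) {ξ : E}
    (hξ : Gen V ξ) (m : ℝ) : (Nset V L ht ξ m).ncard
      = ∑ T ∈ feas V c, (Gset L ht T (fun i => lam T i ξ) ∅ m).ncard := by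
  classical
  obtain ⟨h1, h2⟩ := Nset_eq (L := L) S hc hξ m
  rw [h1]
  have : ∀ F ⊆ feas V c, (⋃ T ∈ F, Gset L ht T (fun i => lam T i ξ) ∅ m).Finite ∧
    (⋃ T ∈ F, Gset L ht T (fun i => lam T i ξ) ∅ m).ncard
      = ∑ T ∈ F, (Gset L ht T (fun i => lam T i ξ) ∅ m).ncard := by
    intro F
    induction F using Finset.induction_on with
    | empty => intro _; simp
    | insert T F hTF ih =>
      intro hF
      have hF' : F ⊆ feas V c := fun x hx => hF (Finset.mem_insert_of_mem hx)
      have hT := hF (Finset.mem_insert_self _ _)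
      obtain ⟨ih1, ih2⟩ := ih hF'
      have hfin := Gset_finite S hL (mem_feas.1 hT).1 (fun i => lam T i ξ) ∅ m
      rw [Finset.set_biUnion_insert]
      refine ⟨hfin.union ih1, ?_⟩
      rw [Set.ncard_union_eq _ hfin ih1, ih2, Finset.sum_insert hTF]
      rw [Set.disjoint_iUnion₂_right]
      intro T' hT'
      exact h2 T hT T' (hF' hT') (by rintro rfl; exact hTF hT')
  exact (this _ subset_rfl).2

noncomputable def nser (V : Finset E) (L : AddSubgroup E) (ht : E →ₗ[ℝ] ℝ) (ξ : E) :
    PowerSeries ℤ := PowerSeries.mk fun n => ((Nset V L ht ξ n).ncard : ℤ)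

lemma Gen.neg {ξ : E} (h : Gen V ξ) : Gen V (-ξ) := by
  intro T hT i hi
  rw [map_neg, neg_ne_zero]
  exact h T hT i hi

theorem reciprocity [FiniteDimensional ℝ E] (S : Setup V ht q) (hL : LFin V L)
    (hVL : ∀ w ∈ V, w ∈ L) {ξ : E} (hξ : Gen V ξ) (k : ℕ) (hk : k ≤ q * Module.finrank ℝ E) :
    PowerSeries.coeff k ((1 - PowerSeries.X ^ q) ^ (Module.finrank ℝ E) * nser V L ht ξ) =
    PowerSeries.coeff (q * Module.finrank ℝ E - k)
      ((1 - PowerSeries.X ^ q) ^ (Module.finrank ℝ E) * nser V L ht (-ξ)) := by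
  obtain ⟨c, hc⟩ := exists_GenC V
  have key : ∀ ξ : E, Gen V ξ → (1 - PowerSeries.X ^ q) ^ (Module.finrank ℝ E) * nser V L ht ξ
      = ∑ T ∈ feas V c, gser L ht T (fun i => lam T i ξ) T := by
    intro ξ hξ
    have : nser V L ht ξ = ∑ T ∈ feas V c, gser L ht T (fun i => lam T i ξ) ∅ := by
      ext n
      simp only [nser, gser, PowerSeries.coeff_mk, map_sum, Nset_ncard S hL hc hξ, Nat.cast_sum]
    rw [this, Finset.mul_sum]
    apply Finset.sum_congr rfl
    intro T hT
    have hT := (mem_feas.1 hT).1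
    rw [← (dual_lam hT).card (S.notMem hT), gser_all S hL hVL hT]
  rw [key ξ hξ, key _ hξ.neg, map_sum, map_sum]
  apply Finset.sum_congr rfl
  intro T hT
  have hT := (mem_feas.1 hT).1
  simp only [gser, PowerSeries.coeff_mk, map_neg]
  rw [Gset_recip S hVL hT (fun i hi => hξ T hT i hi), (dual_lam hT).card (S.notMem hT)]
  rw [Nat.cast_sub hk]; push_cast; rfl
end
end

section
open Filter Topology

lemma ev_nonneg_iff {a b : ℝ} (hb : b ≠ 0) :
    (∀ᶠ e in 𝓝[>] (0 : ℝ), 0 ≤ a + e * b) ↔ lpos a b := by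
  constructor
  · intro h
    obtain ⟨e, he, h1, h2⟩ := (h.and (eventually_lpos (a := a) hb)).exists
    exact h2.1 (lt_of_le_of_ne he h1.symm)
  · intro h
    filter_upwards [eventually_lpos (a := a) hb] with e he
    exact (he.2.2 h).le

lemma ev_pos_iff {a b : ℝ} (hb : b ≠ 0) :
    (∀ᶠ e in 𝓝[>] (0 : ℝ), 0 < a + e * b) ↔ lpos a b := by
  constructor
  · intro h
    obtain ⟨e, he, h1, h2⟩ := (h.and (eventually_lpos (a := a) hb)).exists
    exact h2.1 he
  · intro h
    filter_upwards [eventually_lpos (a := a) hb] with e he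
    exact he.2.2 h

lemma lpos_of_pos {a b : ℝ} (hb : 0 < b) : lpos a b ↔ 0 ≤ a := by
  unfold lpos
  rw [le_iff_lt_or_eq]; simp [hb, eq_comm]

lemma lpos_of_neg {a b : ℝ} (hb : b < 0) : lpos a b ↔ 0 < a := by
  unfold lpos
  simp [not_lt.2 hb.le]

def latL (d : ℕ) : AddSubgroup ((Fin d → ℝ) × ℝ) where
  carrier := {x | IsLatticePt x.1 ∧ ∃ a : ℤ, x.2 = a}
  zero_mem' := ⟨fun i => ⟨0, by simp⟩, 0, by simp⟩
  add_mem' := by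
    rintro x y ⟨hx, a, ha⟩ ⟨hy, b, hb⟩
    refine ⟨fun i => ?_, a + b, by simp [ha, hb]⟩
    obtain ⟨c, hc⟩ := hx i
    obtain ⟨e, he⟩ := hy i
    exact ⟨c + e, by simp [hc, he]⟩
  neg_mem' := by
    rintro x ⟨hx, a, ha⟩
    refine ⟨fun i => ?_, -a, by simp [ha]⟩
    obtain ⟨c, hc⟩ := hx i
    exact ⟨-c, by simp [hc]⟩

lemma mem_latL {d : ℕ} {x : (Fin d → ℝ) × ℝ} :
    x ∈ latL d ↔ IsLatticePt x.1 ∧ ∃ a : ℤ, x.2 = a := Iff.rfl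

lemma latL_bdd_finite {d : ℕ} (B : ℝ) : {x | x ∈ latL d ∧ ‖x‖ ≤ B}.Finite := by
  obtain ⟨N, hN⟩ := exists_nat_ge B
  let φ : (Fin d → ℤ) × ℤ → (Fin d → ℝ) × ℝ := fun y => (fun i => (y.1 i : ℝ), (y.2 : ℝ))
  refine (((Set.finite_Icc (fun _ : Fin d => -(N : ℤ)) (fun _ => (N : ℤ))).prod
    (Set.finite_Icc (-(N : ℤ)) (N : ℤ))).image φ).subset ?_
  rintro x ⟨hx, hxB⟩
  obtain ⟨h1, a, ha⟩ := mem_latL.1 hx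
  choose y hy using h1
  refine ⟨(y, a), ?_, ?_⟩
  · have hyN : ∀ i, |y i| ≤ N := by
      intro i
      have h2 : ‖x.1 i‖ ≤ N := ((norm_le_pi_norm x.1 i).trans (norm_fst_le x)).trans (hxB.trans hN)
      rw [hy i, Real.norm_eq_abs] at h2
      exact_mod_cast h2
    have haN : |a| ≤ N := by
      have h2 : ‖x.2‖ ≤ N := (norm_snd_le x).trans (hxB.trans hN)
      rw [ha, Real.norm_eq_abs] at h2
      exact_mod_cast h2
    exact ⟨⟨fun i => (abs_le.1 (hyN i)).1, fun i => (abs_le.1 (hyN i)).2⟩,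
      ⟨(abs_le.1 haN).1, (abs_le.1 haN).2⟩⟩
  · apply Prod.ext
    · funext i; exact (hy i).symm
    · exact ha.symm

lemma latL_LFin {d : ℕ} (V : Finset ((Fin d → ℝ) × ℝ)) : LFin V (latL d) := by
  intro T hT M
  refine (latL_bdd_finite (∑ i ∈ T, M * ‖i‖)).subset ?_
  rintro x ⟨hx, hM⟩
  refine ⟨hx, ?_⟩
  have := (dual_lam hT).1 x
  rw [← this]
  refine (norm_sum_le _ _).trans ?_
  apply Finset.sum_le_sum
  intro i hi
  rw [norm_smul]
  exact mul_le_mul_of_nonneg_right (hM i hi) (norm_nonneg _)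

noncomputable def fA {d m : ℕ} (A : Fin m → Fin d → ℤ) (j : Fin m) : (Fin d → ℝ) →ₗ[ℝ] ℝ :=
  ∑ i, (A j i : ℝ) • LinearMap.proj i

lemma fA_apply {d m : ℕ} (A : Fin m → Fin d → ℤ) (j : Fin m) (x : Fin d → ℝ) :
    fA A j x = ∑ i, (A j i : ℝ) * x i := by
  simp [fA]

lemma fA_int {d m : ℕ} (A : Fin m → Fin d → ℤ) (j : Fin m) {x : Fin d → ℝ} (hx : IsLatticePt x) :
    ∃ a : ℤ, fA A j x = a := by
  choose y hy using hx
  exact ⟨∑ i, A j i * y i, by simp [fA_apply, hy]⟩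

lemma mem_dilate {d m : ℕ} {A : Fin m → Fin d → ℤ} {P : Set (Fin d → ℝ)}
    (hP : P = {x : Fin d → ℝ | ∀ j, (∑ i, (A j i : ℝ) * x i) ≤ 1}) {t : ℝ} (ht : 0 < t)
    (v : Fin d → ℝ) : v ∈ t • P ↔ ∀ j, fA A j v ≤ t := by
  rw [Set.mem_smul_set_iff_inv_smul_mem₀ ht.ne', hP]
  apply forall_congr'
  intro j
  rw [← fA_apply, map_smul, smul_eq_mul, inv_mul_le_iff₀ ht, mul_one]

open Classical in
noncomputable def liftV {d : ℕ} (V : Finset (Fin d → ℝ)) (q : ℕ) : Finset ((Fin d → ℝ) × ℝ) :=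
  V.image fun w => (w, (q : ℝ))

lemma mem_liftV {d : ℕ} {V : Finset (Fin d → ℝ)} {q : ℕ} {x : (Fin d → ℝ) × ℝ} :
    x ∈ liftV V q ↔ x.1 ∈ V ∧ x.2 = q := by
  classical
  simp only [liftV, Finset.mem_image]
  constructor
  · rintro ⟨w, hw, rfl⟩; exact ⟨hw, rfl⟩
  · rintro ⟨h1, h2⟩; exact ⟨x.1, h1, by rw [← h2]⟩

lemma cone_iff {d m q : ℕ} {A : Fin m → Fin d → ℤ} {P : Set (Fin d → ℝ)}
    (hP : P = {x : Fin d → ℝ | ∀ j, (∑ i, (A j i : ℝ) * x i) ≤ 1}) (hq : 0 < q)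
    {V : Finset (Fin d → ℝ)} (hV : (q : ℝ) • P = convexHull ℝ (V : Set (Fin d → ℝ)))
    {z : (Fin d → ℝ) × ℝ} (hz : 0 < z.2) :
    z ∈ coneOf (liftV V q) ↔ ∀ j, fA A j z.1 ≤ z.2 := by
  classical
  have hq' : (0 : ℝ) < q := by exact_mod_cast hq
  constructor
  · rintro ⟨a, ha, rfl⟩ j
    rw [Prod.fst_sum, Prod.snd_sum, map_sum]
    apply Finset.sum_le_sum
    intro i hi
    obtain ⟨h1, h2⟩ := mem_liftV.1 hi
    have h3 : i.1 ∈ (q : ℝ) • P := by rw [hV]; exact subset_convexHull ℝ _ h1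
    have h4 := (mem_dilate hP hq' i.1).1 h3 j
    rw [Prod.smul_fst, Prod.smul_snd, map_smul, h2]
    exact mul_le_mul_of_nonneg_left h4 (ha i hi)
  · intro h
    have h1 : ((q : ℝ) / z.2) • z.1 ∈ (q : ℝ) • P := by
      rw [mem_dilate hP hq']
      intro j
      rw [map_smul, smul_eq_mul, div_mul_eq_mul_div, div_le_iff₀ hz]
      exact mul_le_mul_of_nonneg_left (h j) hq'.le
    rw [hV, Finset.mem_convexHull'] at h1
    obtain ⟨a, ha, ha1, haz⟩ := h1
    refine ⟨fun e => (z.2 / q) * a e.1, ?_, ?_⟩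
    · intro i hi
      exact mul_nonneg (div_pos hz hq').le (ha _ (mem_liftV.1 hi).1)
    · rw [liftV, Finset.sum_image (by intro x _ y _ hxy; exact (Prod.ext_iff.1 hxy).1)]
      apply Prod.ext
      · rw [Prod.fst_sum]
        simp only [Prod.smul_fst, ← smul_smul]
        rw [← Finset.smul_sum, haz, smul_smul, div_mul_div_cancel₀ hq'.ne', div_self hz.ne', one_smul]
      · rw [Prod.snd_sum]
        simp only [Prod.smul_snd, smul_eq_mul]
        rw [← Finset.sum_mul, ← Finset.mul_sum, ha1]
        field_simp

lemma setup_lift {d m q : ℕ} {A : Fin m → Fin d → ℤ} {P : Set (Fin d → ℝ)}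
    (hP : P = {x : Fin d → ℝ | ∀ j, (∑ i, (A j i : ℝ) * x i) ≤ 1}) (hq : 0 < q)
    {V : Finset (Fin d → ℝ)} (hV : (q : ℝ) • P = convexHull ℝ (V : Set (Fin d → ℝ))) :
    Setup (liftV V q) (LinearMap.snd ℝ (Fin d → ℝ) ℝ) q := by
  have hsub : coneOf (liftV V q) ⊆ (Submodule.span ℝ (liftV V q : Set ((Fin d → ℝ) × ℝ)) : Set _) := by
    rintro z ⟨a, _, rfl⟩
    exact Submodule.sum_mem _ fun i hi => Submodule.smul_mem _ _ (Submodule.subset_span hi)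
  refine ⟨hq, ?_, ?_, ?_⟩
  · by_contra hn
    rw [Finset.not_nonempty_iff_eq_empty] at hn
    have h1 : ((0 : Fin d → ℝ), (1 : ℝ)) ∈ coneOf (liftV V q) := by
      rw [cone_iff hP hq hV (by simp)]
      intro j; simp
    obtain ⟨a, _, h2⟩ := h1
    rw [hn, Finset.sum_empty] at h2
    have := congrArg Prod.snd h2
    simp at this
  · intro w hw; exact (mem_liftV.1 hw).2
  · rintro ⟨v, t⟩ _
    set s : ℝ := 1 + |t| + ∑ j, |fA A j v| with hs
    have hsn : 0 ≤ ∑ j, |fA A j v| := Finset.sum_nonneg fun _ _ => abs_nonneg _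
    have ht := neg_abs_le t
    have ht' := abs_nonneg t
    have h1 : (v, t + s) ∈ coneOf (liftV V q) := by
      rw [cone_iff hP hq hV (by show 0 < t + s; linarith)]
      intro j
      have h2 : |fA A j v| ≤ ∑ j, |fA A j v| :=
        Finset.single_le_sum (f := fun j => |fA A j v|) (fun _ _ => abs_nonneg _) (Finset.mem_univ j)
      have := le_abs_self (fA A j v)
      show fA A j v ≤ t + s
      linarith
    have h2 : ((0 : Fin d → ℝ), s) ∈ coneOf (liftV V q) := by
      rw [cone_iff hP hq hV (by show 0 < s; linarith)]
      intro j
      simp only [map_zero]; linarith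
    have := Submodule.sub_mem _ (hsub h1) (hsub h2)
    simpa using this

lemma exists_xi {d m q : ℕ} (A : Fin m → Fin d → ℤ) {V : Finset ((Fin d → ℝ) × ℝ)}
    (S : Setup V (LinearMap.snd ℝ (Fin d → ℝ) ℝ) q) :
    ∃ ξ, Gen V ξ ∧ 0 < ξ.2 ∧ ∀ j, fA A j ξ.1 < ξ.2 := by
  obtain ⟨x, hx⟩ := exists_Gen V S.zero_notMem
  have h1 : ∀ᶠ e in 𝓝[>] (0 : ℝ), Gen V (((0 : Fin d → ℝ), (1 : ℝ)) + e • x) := by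
    unfold Gen
    rw [Filter.eventually_all_finset]
    intro T hT
    rw [Filter.eventually_all_finset]
    intro i hi
    filter_upwards [eventually_lpos (a := lam T i (0, 1)) (hx T hT i hi)] with e he
    simpa using he.1
  have hpos : ∀ b : ℝ, ∀ᶠ e in 𝓝[>] (0 : ℝ), 0 < 1 + e * b := by
    intro b
    by_cases hb : b = 0
    · simp [hb]
    · exact (ev_pos_iff hb).2 (Or.inl one_pos)
  have h3 : ∀ᶠ e in 𝓝[>] (0 : ℝ), ∀ j, 0 < 1 + e * (x.2 - fA A j x.1) :=
    Filter.eventually_all.2 fun j => hpos _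
  obtain ⟨e, h1, h2, h3⟩ := (h1.and ((hpos x.2).and h3)).exists
  refine ⟨_, h1, by simpa using h2, fun j => ?_⟩
  have := h3 j
  simp only [Prod.fst_add, Prod.snd_add, Prod.smul_fst, Prod.smul_snd, zero_add, map_smul,
    smul_eq_mul]
  linarith

lemma mem_Nset_lift {d m q : ℕ} {A : Fin m → Fin d → ℤ} {P : Set (Fin d → ℝ)}
    (hP : P = {x : Fin d → ℝ | ∀ j, (∑ i, (A j i : ℝ) * x i) ≤ 1}) (hq : 0 < q)
    {V : Finset (Fin d → ℝ)} (hV : (q : ℝ) • P = convexHull ℝ (V : Set (Fin d → ℝ)))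
    {ξ : (Fin d → ℝ) × ℝ} (h2 : ξ.2 ≠ 0) (hj : ∀ j, ξ.2 - fA A j ξ.1 ≠ 0) (n : ℝ)
    (x : (Fin d → ℝ) × ℝ) :
    x ∈ Nset (liftV V q) (latL d) (LinearMap.snd ℝ (Fin d → ℝ) ℝ) ξ n ↔
      x ∈ latL d ∧ x.2 = n ∧ lpos n ξ.2 ∧ ∀ j, lpos (n - fA A j x.1) (ξ.2 - fA A j ξ.1) := by
  unfold Nset
  simp only [Set.mem_ofPred_eq, LinearMap.snd_apply]
  refine and_congr_right fun _ => and_congr_right fun hxn => ?_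
  rw [← ev_pos_iff h2]
  simp only [← fun j => ev_nonneg_iff (a := n - fA A j x.1) (hj j)]
  rw [← Filter.eventually_all, ← Filter.eventually_and]
  apply Filter.eventually_congr
  refine Filter.Eventually.of_forall fun e => ?_
  have e1 : (x + e • ξ).2 = n + e * ξ.2 := by simp [hxn]
  rw [and_comm, e1]
  refine and_congr_right fun hp => ?_
  rw [cone_iff hP hq hV (by rw [e1]; exact hp), e1]
  apply forall_congr'
  intro j
  rw [Prod.fst_add, Prod.smul_fst, map_add, map_smul, smul_eq_mul, ← sub_nonneg]
  apply iff_of_eq; congr 1; ring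

lemma ncard_slice {d : ℕ} (Q : (Fin d → ℝ) → Prop) (n : ℕ) :
    {x : (Fin d → ℝ) × ℝ | x ∈ latL d ∧ x.2 = n ∧ Q x.1}.ncard
      = {v | IsLatticePt v ∧ Q v}.ncard := by
  have : {x : (Fin d → ℝ) × ℝ | x ∈ latL d ∧ x.2 = n ∧ Q x.1}
      = (fun v => (v, (n : ℝ))) '' {v | IsLatticePt v ∧ Q v} := by
    ext x
    constructor
    · rintro ⟨h1, h2, h3⟩
      exact ⟨x.1, ⟨h1.1, h3⟩, by rw [← h2]⟩
    · rintro ⟨v, ⟨h1, h2⟩, rfl⟩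
      exact ⟨⟨h1, n, by simp⟩, rfl, h2⟩
  rw [this, Set.ncard_image_of_injective]
  intro a b hab
  exact (Prod.ext_iff.1 hab).1

end

/-- **Statement 13.** If `P ⊆ ℝ^d` is a full-dimensional rational reflexive polytope with
denominator `q`, then `h*_P` has degree `q(d+1)−1` and is palindromic:
`z^{q(d+1)−1} h*_P(1/z) = h*_P(z)`. -/
theorem rational_reflexive_hstar_palindromic {d q : ℕ} (P : Set (Fin d → ℝ))
    (hfull : IsFullDim P) (hrefl : IsRationalReflexive P) (hq : IsDenominator P q)
    (hP : Polynomial ℤ) (hPdeg : hP.natDegree < q * (d + 1))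
    (hPeq : (hP : PowerSeries ℤ) = (1 - PowerSeries.X ^ q) ^ (d + 1) * ehrSeries P) :
    hP.natDegree = q * (d + 1) - 1 ∧
    ∀ i ≤ q * (d + 1) - 1, hP.coeff i = hP.coeff (q * (d + 1) - 1 - i) := by
  obtain ⟨hq0, ⟨V, hVlat, hV⟩, -⟩ := hq
  obtain ⟨-, -, m, A, hA⟩ := hrefl
  have S := setup_lift hA hq0 hV
  obtain ⟨ξ, hgen, hξ2, hξj⟩ := exists_xi A S
  set W := liftV V q with hW
  set ht := LinearMap.snd ℝ (Fin d → ℝ) ℝ with hht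
  have hplus : ∀ n : ℕ, (Nset W (latL d) ht ξ n).ncard
      = {v | IsLatticePt v ∧ ∀ j, fA A j v ≤ n}.ncard := by
    intro n
    rw [← ncard_slice (fun v => ∀ j, fA A j v ≤ n) n]
    congr 1
    ext x
    rw [mem_Nset_lift hA hq0 hV hξ2.ne' (fun j => (sub_pos.2 (hξj j)).ne') n x]
    simp only [lpos_of_pos hξ2, fun j => lpos_of_pos (a := n - fA A j x.1) (sub_pos.2 (hξj j)),
      sub_nonneg, Nat.cast_nonneg, true_and, Set.mem_ofPred_eq]
  have hminus : ∀ n : ℕ, ∀ x, x ∈ Nset W (latL d) ht (-ξ) n ↔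
      x ∈ latL d ∧ x.2 = n ∧ 0 < (n : ℝ) ∧ ∀ j, fA A j x.1 < n := by
    intro n x
    have h2 : (-ξ).2 < 0 := by simpa using hξ2
    have hj : ∀ j, (-ξ).2 - fA A j (-ξ).1 < 0 := by
      intro j
      have := hξj j
      simp only [Prod.fst_neg, Prod.snd_neg, map_neg]
      linarith
    rw [mem_Nset_lift hA hq0 hV h2.ne (fun j => (hj j).ne) n x]
    simp only [lpos_of_neg h2, fun j => lpos_of_neg (a := n - fA A j x.1) (hj j), sub_pos]
  have hint : nser W (latL d) ht (-ξ) = PowerSeries.X * nser W (latL d) ht ξ := by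
    ext n
    rcases n with _ | n
    · rw [PowerSeries.coeff_zero_X_mul]
      simp only [nser, PowerSeries.coeff_mk]
      have : Nset W (latL d) ht (-ξ) ((0 : ℕ) : ℝ) = ∅ := by
        rw [Set.eq_empty_iff_forall_notMem]
        intro x hx
        have := ((hminus 0 x).1 hx).2.2.1
        simp at this
      rw [this]; simp
    · rw [mul_comm, PowerSeries.coeff_succ_mul_X]
      simp only [nser, PowerSeries.coeff_mk]
      rw [hplus n, ← ncard_slice (fun v => ∀ j, fA A j v ≤ n) (n + 1)]
      congr 2
      ext x
      rw [hminus]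
      refine and_congr_right fun hx => and_congr_right fun _ => ?_
      rw [and_iff_right (by positivity)]
      apply forall_congr'
      intro j
      obtain ⟨a, ha⟩ := fA_int A j hx.1
      rw [ha]
      have e1 : ((a : ℝ) < ((n + 1 : ℕ) : ℝ)) ↔ a < ((n + 1 : ℕ) : ℤ) := by
        rw [← Int.cast_natCast, Int.cast_lt]
      have e2 : ((a : ℝ) ≤ (n : ℝ)) ↔ a ≤ (n : ℤ) := by
        rw [← Int.cast_natCast, Int.cast_le]
      rw [e1, e2]
      omega
  have hzero : Nset W (latL d) ht ξ ((0 : ℕ) : ℝ) = {0} := by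
    obtain ⟨c, hc⟩ := exists_GenC W
    ext x
    constructor
    · intro hx
      rw [(Nset_eq S hc hgen _).1] at hx
      simp only [Set.mem_iUnion] at hx
      obtain ⟨T, hT, hx⟩ := hx
      have hT := (mem_feas.1 hT).1
      obtain ⟨h1, -, h3⟩ := Gset_bound S hT hx
      have h4 := (dual_lam hT).1 x
      rw [Set.mem_singleton_iff, ← h4]
      apply Finset.sum_eq_zero
      intro i hi
      have hq' : (0 : ℝ) < q := by exact_mod_cast hq0
      have h5 := h3 i hi
      have h6 := h1 i hi
      have : lam T i x = 0 := by
        push_cast at h5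
        nlinarith
      rw [this, zero_smul]
    · rintro rfl
      rw [mem_Nset_lift hA hq0 hV hξ2.ne' (fun j => (sub_pos.2 (hξj j)).ne')]
      refine ⟨zero_mem _, by simp, by simp [lpos, hξ2], fun j => ?_⟩
      rw [lpos_of_pos (sub_pos.2 (hξj j))]; simp
  have hehr : ehrSeries P = nser W (latL d) ht ξ := by
    ext n
    simp only [ehrSeries, nser, PowerSeries.coeff_mk]
    split_ifs with hn
    · subst hn
      rw [hzero]; simp
    · rw [hplus, latCount]
      congr 2
      ext v
      rw [Set.mem_ofPred_eq, Set.mem_ofPred_eq, and_comm,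
        mem_dilate hA (by exact_mod_cast Nat.pos_of_ne_zero hn)]
  have hVL : ∀ w ∈ W, w ∈ latL d := by
    intro w hw
    obtain ⟨h1, h2⟩ := mem_liftV.1 hw
    exact ⟨hVlat _ h1, q, by simpa using h2⟩
  have hfr : Module.finrank ℝ ((Fin d → ℝ) × ℝ) = d + 1 := by simp
  have hD : 0 < q * (d + 1) := Nat.mul_pos hq0 (Nat.succ_pos d)
  have hpal : ∀ i ≤ q * (d + 1) - 1, hP.coeff i = hP.coeff (q * (d + 1) - 1 - i) := by
    intro i hi
    have hr := reciprocity S (latL_LFin W) hVL hgen i (by rw [hfr]; omega)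
    rw [hfr, hint, ← mul_assoc, mul_comm _ PowerSeries.X, mul_assoc, ← hehr, ← hPeq,
      show q * (d + 1) - i = (q * (d + 1) - 1 - i) + 1 by omega, mul_comm PowerSeries.X,
      PowerSeries.coeff_succ_mul_X, Polynomial.coeff_coe, Polynomial.coeff_coe] at hr
    exact hr
  refine ⟨?_, hpal⟩
  have h0 : hP.coeff 0 = 1 := by
    rw [← Polynomial.coeff_coe, hPeq, PowerSeries.coeff_zero_eq_constantCoeff_apply, map_mul,
      map_pow, map_sub, map_pow, PowerSeries.constantCoeff_X, zero_pow hq0.ne']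
    rw [← PowerSeries.coeff_zero_eq_constantCoeff_apply (ehrSeries P)]
    simp [ehrSeries]
  have h1 := hpal 0 (Nat.zero_le _)
  rw [h0, Nat.sub_zero] at h1
  have h2 : q * (d + 1) - 1 ≤ hP.natDegree :=
    Polynomial.le_natDegree_of_ne_zero (by rw [← h1]; exact one_ne_zero)
  omega
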